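/- Let R be a commutative ring and ∂: P₁ → P₀ an R-linear map between R-modules, with M = coker(∂). Then the second exterior power Λ²_R(M) is isomorphic to the cokernel of the map P₀ ⊗_R P₁ → Λ²_R(P₀) sending p₀ ⊗ p₁ to p₀ ∧ ∂(p₁); the isomorphism is induced by the canonical surjection P₀ → M. -/

import Mathlib

open scoped TensorProduct

/-- The relation submodule defining the second exterior power: the span of all `p ⊗ p`. -/
noncomputable def altRel (R P : Type*) [CommRing R] [AddCommGroup P] [Module R P] :
    Submodule R (TensorProduct R P P) :=
  Submodule.span R {z : TensorProduct R P P | ∃ p : P, z = p ⊗ₜ[R] p}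

/-- The second exterior power `Λ²_R(P)`, the quotient of `P ⊗[R] P` by the span of all
`p ⊗ p`. -/
noncomputable def Lam2Pow (R P : Type*) [CommRing R] [AddCommGroup P] [Module R P] : Type _ :=
  (TensorProduct R P P) ⧸ altRel R P

noncomputable instance (R P : Type*) [CommRing R] [AddCommGroup P] [Module R P] :
    AddCommGroup (Lam2Pow R P) :=
  inferInstanceAs (AddCommGroup ((TensorProduct R P P) ⧸ altRel R P))

noncomputable instance (R P : Type*) [CommRing R] [AddCommGroup P] [Module R P] :
    Module R (Lam2Pow R P) :=
  inferInstanceAs (Module R ((TensorProduct R P P) ⧸ altRel R P))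

/-- The class of `x ⊗ y` in `Λ²_R(P)`, i.e. the wedge `x ∧ y`. -/
noncomputable def Lam2Pow.mk {R P : Type*} [CommRing R] [AddCommGroup P] [Module R P]
    (x y : P) : Lam2Pow R P :=
  Submodule.Quotient.mk (x ⊗ₜ[R] y)

namespace Lam2Pow

variable {R P Q : Type*} [CommRing R] [AddCommGroup P] [Module R P] [AddCommGroup Q] [Module R Q]

/-- The wedge product `P → P → Λ²_R(P)` as a bilinear map. -/
noncomputable def wedge (R P : Type*) [CommRing R] [AddCommGroup P] [Module R P] :
    P →ₗ[R] P →ₗ[R] Lam2Pow R P :=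
  (TensorProduct.mk R P P).compr₂ (altRel R P).mkQ

theorem wedge_apply (x y : P) : wedge R P x y = mk x y := rfl

theorem wedge_self (x : P) : wedge R P x x = 0 :=
  (Submodule.Quotient.mk_eq_zero _).2 (Submodule.subset_span ⟨x, rfl⟩)

theorem wedge_swap (x y : P) : wedge R P x y = -wedge R P y x := by
  have h := wedge_self (R := R) (x + y)
  simp only [map_add, LinearMap.add_apply, wedge_self, zero_add, add_zero] at h
  exact eq_neg_of_add_eq_zero_right h

/-- The linear map out of `Λ²_R(P)` induced by an alternating bilinear map. -/
noncomputable def lift (B : P →ₗ[R] P →ₗ[R] Q) (hB : ∀ x, B x x = 0) : Lam2Pow R P →ₗ[R] Q :=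
  (altRel R P).liftQ (TensorProduct.lift B) <| Submodule.span_le.2 <| by
    rintro _ ⟨x, rfl⟩
    simp [hB]

theorem lift_wedge (B : P →ₗ[R] P →ₗ[R] Q) (hB : ∀ x, B x x = 0) (x y : P) :
    lift B hB (wedge R P x y) = B x y :=
  TensorProduct.lift.tmul x y

theorem hom_ext {f g : Lam2Pow R P →ₗ[R] Q}
    (h : ∀ x y, f (wedge R P x y) = g (wedge R P x y)) : f = g :=
  Submodule.linearMap_qext (altRel R P) (TensorProduct.ext' h)

/-- The bilinear map on `P ⧸ S` induced by a bilinear map on `P` that vanishes when either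
argument lies in `S`. -/
noncomputable def liftQuotient (S : Submodule R P) (B : P →ₗ[R] P →ₗ[R] Q)
    (hl : ∀ x ∈ S, ∀ y, B x y = 0) (hr : ∀ x, ∀ y ∈ S, B x y = 0) :
    (P ⧸ S) →ₗ[R] (P ⧸ S) →ₗ[R] Q :=
  (S.liftQ (S.liftQ B fun x hx => LinearMap.ext (hl x hx)).flip fun y hy => by
    refine LinearMap.mem_ker.2 (LinearMap.ext fun z => ?_)
    obtain ⟨x, rfl⟩ := S.mkQ_surjective z
    exact hr x y hy).flip

theorem liftQuotient_mkQ (S : Submodule R P) (B : P →ₗ[R] P →ₗ[R] Q)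
    (hl : ∀ x ∈ S, ∀ y, B x y = 0) (hr : ∀ x, ∀ y ∈ S, B x y = 0) (x y : P) :
    liftQuotient S B hl hr (S.mkQ x) (S.mkQ y) = B x y := rfl

/-- If `N` is the submodule of `Λ²_R(P)` generated by all `x ∧ s` with `s ∈ S`, then
`Λ²_R(P) ⧸ N` is `Λ²_R(P ⧸ S)`. -/
theorem exists_quotientEquiv (S : Submodule R P) (N : Submodule R (Lam2Pow R P))
    (hN : N = Submodule.span R {z | ∃ x, ∃ s ∈ S, wedge R P x s = z}) :
    ∃ e : (Lam2Pow R P ⧸ N) ≃ₗ[R] Lam2Pow R (P ⧸ S),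
      ∀ x y, e (N.mkQ (wedge R P x y)) = wedge R (P ⧸ S) (S.mkQ x) (S.mkQ y) := by
  have hr : ∀ x, ∀ y ∈ S, N.mkQ (wedge R P x y) = 0 := fun x y hy =>
    (Submodule.Quotient.mk_eq_zero _).2 (hN ▸ Submodule.subset_span ⟨x, y, hy, rfl⟩)
  have hl : ∀ x ∈ S, ∀ y, N.mkQ (wedge R P x y) = 0 := fun x hx y => by
    rw [wedge_swap, map_neg, hr y x hx, neg_zero]
  let φ : Lam2Pow R P →ₗ[R] Lam2Pow R (P ⧸ S) :=
    lift ((wedge R (P ⧸ S)).compl₁₂ S.mkQ S.mkQ) fun x => wedge_self (S.mkQ x)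
  have hφ : ∀ x y, φ (wedge R P x y) = wedge R (P ⧸ S) (S.mkQ x) (S.mkQ y) :=
    fun x y => lift_wedge _ _ x y
  have hker : N ≤ LinearMap.ker φ := by
    rw [hN, Submodule.span_le]
    rintro _ ⟨x, s, hs, rfl⟩
    have h0 : S.mkQ s = 0 := (Submodule.Quotient.mk_eq_zero S).2 hs
    simp [hφ, h0, -Submodule.mkQ_apply]
  let B := liftQuotient S ((wedge R P).compr₂ N.mkQ) hl hr
  have hB : ∀ z, B z z = 0 := fun z => by
    obtain ⟨x, rfl⟩ := S.mkQ_surjective z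
    change N.mkQ (wedge R P x x) = 0
    rw [wedge_self, map_zero]
  have hψ : ∀ x y, lift B hB (wedge R (P ⧸ S) (S.mkQ x) (S.mkQ y)) = N.mkQ (wedge R P x y) :=
    fun x y => (lift_wedge B hB _ _).trans (liftQuotient_mkQ S _ hl hr x y)
  have hφq : ∀ x y, N.liftQ φ hker (N.mkQ (wedge R P x y)) =
      wedge R (P ⧸ S) (S.mkQ x) (S.mkQ y) := hφ
  refine ⟨LinearEquiv.ofLinearMap (N.liftQ φ hker) (lift B hB) ?_ ?_, hφq⟩
  · refine hom_ext fun z w => ?_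
    obtain ⟨x, rfl⟩ := S.mkQ_surjective z
    obtain ⟨y, rfl⟩ := S.mkQ_surjective w
    rw [LinearMap.comp_apply, hψ, hφq, LinearMap.id_apply]
  · refine Submodule.linearMap_qext N (hom_ext fun x y => ?_)
    rw [LinearMap.comp_apply, LinearMap.comp_apply, hφq, hψ, LinearMap.comp_apply,
      LinearMap.id_apply]

end Lam2Pow

/-- Let `∂ : P₁ → P₀` be an `R`-linear map with cokernel `M`. Then
`Λ²_R(M)` is isomorphic to the cokernel of the map `P₀ ⊗_R P₁ → Λ²_R(P₀)`,
`p₀ ⊗ p₁ ↦ p₀ ∧ ∂(p₁)`, via the isomorphism induced by the canonical surjection `P₀ → M`. -/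
theorem stmt9 (R P₀ P₁ : Type) [CommRing R] [AddCommGroup P₀] [Module R P₀]
    [AddCommGroup P₁] [Module R P₁] (d : P₁ →ₗ[R] P₀)
    -- `g : P₀ ⊗ P₁ → Λ²(P₀)`, `p₀ ⊗ p₁ ↦ p₀ ∧ ∂(p₁)`
    (g : TensorProduct R P₀ P₁ →ₗ[R] Lam2Pow R P₀)
    (hg : g = (altRel R P₀).mkQ.comp (TensorProduct.map LinearMap.id d)) :
    ∃ e : (Lam2Pow R P₀ ⧸ LinearMap.range g) ≃ₗ[R]
        Lam2Pow R (P₀ ⧸ LinearMap.range d),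
      ∀ x y : P₀,
        e (Submodule.Quotient.mk (Lam2Pow.mk x y)) =
          Lam2Pow.mk (Submodule.Quotient.mk x) (Submodule.Quotient.mk y) := by
  refine Lam2Pow.exists_quotientEquiv (LinearMap.range d) (LinearMap.range g) ?_
  have hg' : ∀ x y, g (x ⊗ₜ[R] y) = Lam2Pow.wedge R P₀ x (d y) := fun x y => by
    rw [hg]
    rfl
  rw [LinearMap.range_eq_map, ← TensorProduct.span_tmul_eq_top, Submodule.map_span]
  congr 1
  ext z
  constructor
  · rintro ⟨_, ⟨x, y, rfl⟩, rfl⟩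
    exact ⟨x, d y, ⟨y, rfl⟩, (hg' x y).symm⟩
  · rintro ⟨x, _, ⟨y, rfl⟩, rfl⟩
    exact ⟨x ⊗ₜ[R] y, ⟨x, y, rfl⟩, hg' x y⟩
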